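/- Suppose the synchronization costs are uniform, δ(n,l) = δ for all n,l ∈ S with δ ≥ 0, and ε(n,l) ≥ 0 for all n,l ∈ S. Define, for each nonempty X ⊆ S, f(X) = Σ_{m∈C} min_{n∈X} ζ(m,n) + ω · δ · |X| · |C| + ω · Σ_{n∈X} Σ_{l∈X} ε(n,l) (the balanced cost of deployment X under its optimal assignment). Then f is supermodular on nonempty subsets of S: for all nonempty A ⊆ B ⊆ S and every i ∈ S \ B, f(A ∪ {i}) − f(A) ≤ f(B ∪ {i}) − f(B). -/

import Mathlib

open Finset

/-- The minimum of a function over a nonempty finite set is supermodular in the set. -/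
theorem inf'_insert_sub_inf'_le {S : Type*} [DecidableEq S] (z : S → ℝ) {A B : Finset S}
    (hA : A.Nonempty) (hAB : A ⊆ B) (i : S) :
    (insert i A).inf' (insert_nonempty i A) z - A.inf' hA z ≤
      (insert i B).inf' (insert_nonempty i B) z - B.inf' (hA.mono hAB) z := by
  rw [inf'_insert (H := hA), inf'_insert (H := hA.mono hAB), ← min_sub_sub_right,
    ← min_sub_sub_right, sub_self, sub_self]
  exact min_le_min_right _ (sub_le_sub_left (inf'_mono z hAB hA) _)

theorem sum_sum_insert {S : Type*} [DecidableEq S] (ε : S → S → ℝ) {X : Finset S} {i : S}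
    (hi : i ∉ X) :
    ∑ n ∈ insert i X, ∑ l ∈ insert i X, ε n l =
      ∑ n ∈ X, ∑ l ∈ X, ε n l + (ε i i + ∑ l ∈ X, (ε i l + ε l i)) := by
  simp only [sum_insert hi, sum_add_distrib]
  ring

/-- The sum of a nonnegative kernel over the square of a finite set is supermodular in the set. -/
theorem sum_sum_insert_sub_le {S : Type*} [DecidableEq S] (ε : S → S → ℝ)
    (hε : ∀ n l, 0 ≤ ε n l) {A B : Finset S} (hAB : A ⊆ B) {i : S} (hi : i ∉ B) :
    ∑ n ∈ insert i A, ∑ l ∈ insert i A, ε n l - ∑ n ∈ A, ∑ l ∈ A, ε n l ≤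
      ∑ n ∈ insert i B, ∑ l ∈ insert i B, ε n l - ∑ n ∈ B, ∑ l ∈ B, ε n l := by
  rw [sum_sum_insert ε hi, sum_sum_insert ε fun h => hi (hAB h), add_sub_cancel_left,
    add_sub_cancel_left]
  gcongr
  exact fun l _ _ => add_nonneg (hε i l) (hε l i)

/-- under uniform synchronization costs `δ ≥ 0` and nonnegative
constant costs `ε`, the balanced cost of a deployment under its optimal
assignment,
`f(X) = Σ_{m∈C} min_{n∈X} ζ(m,n) + ω·δ·|X|·|C| + ω·Σ_{n∈X}Σ_{l∈X} ε(n,l)`,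
is a supermodular set function on the nonempty subsets of `S`. -/
theorem optimal_balanced_cost_supermodular
    {C S : Type*} [Fintype C] [Fintype S] [DecidableEq S]
    (ζ : C → S → ℝ) (δ : ℝ) (hδ : 0 ≤ δ)
    (ε : S → S → ℝ) (hε : ∀ n l, 0 ≤ ε n l)
    (ω : ℝ) (hω : 0 ≤ ω)
    (f : ∀ X : Finset S, X.Nonempty → ℝ)
    (hf : ∀ (X : Finset S) (hX : X.Nonempty),
      f X hX = (∑ m, X.inf' hX fun n => ζ m n) +
        ω * δ * (X.card : ℝ) * (Fintype.card C : ℝ) +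
        ω * ∑ n ∈ X, ∑ l ∈ X, ε n l) :
    ∀ (A B : Finset S) (hA : A.Nonempty) (hAB : A ⊆ B) (i : S), i ∉ B →
      f (insert i A) (insert_nonempty i A) - f A hA ≤
        f (insert i B) (insert_nonempty i B) - f B (hA.mono hAB) := by
  intro A B hA hAB i hi
  have hmin := sum_le_sum fun m (_ : m ∈ (univ : Finset C)) =>
    inf'_insert_sub_inf'_le (ζ m) hA hAB i
  simp only [sum_sub_distrib] at hmin
  have hsync := mul_le_mul_of_nonneg_left (sum_sum_insert_sub_le ε hε hAB hi) hω
  simp only [hf, card_insert_of_notMem hi, card_insert_of_notMem fun h => hi (hAB h)]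
  push_cast
  linarith
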